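/- Let T ∈ (0, ∞], and let Φ : ℝ → ℝ be continuous on (0, ∞), strictly positive on (0, ∞), and monotone nondecreasing on (0, ∞). Define G(x) = ∫₀ˣ 1/Φ(1/s) ds for x > 0. Let h : [0, T) → ℝ be differentiable with h(t) > 0 and h'(t) ≤ Φ(h(t))·h(t)² for all t ∈ [0, T). Then for every t ∈ [0, T) one has G(1/h(t)) ≥ G(1/h(0)) − t. -/

import Mathlib

open Set

/-- `G(x) = ∫₀ˣ 1/Φ(1/s) ds`. -/
noncomputable def Gfun (Φ : ℝ → ℝ) (x : ℝ) : ℝ :=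
  ∫ s in (0 : ℝ)..x, 1 / Φ (1 / s)

theorem one_div_mem_Ioi_zero {s : ℝ} (hs : s ∈ Ioi (0 : ℝ)) : 1 / s ∈ Ioi (0 : ℝ) :=
  mem_Ioi.2 (one_div_pos.2 (mem_Ioi.1 hs))

/-- The integrand of `Gfun` is interval integrable up to the left endpoint `0`, where its value
is irrelevant. -/
theorem intervalIntegrable_one_div_comp_one_div {Φ : ℝ → ℝ} (hΦpos : ∀ x ∈ Ioi (0 : ℝ), 0 < Φ x)
    (hΦmono : MonotoneOn Φ (Ioi 0)) {x : ℝ} (hx : 0 < x) :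
    IntervalIntegrable (fun s => 1 / Φ (1 / s)) MeasureTheory.volume 0 x := by
  have hmono : Monotone ((Ioi (0 : ℝ)).indicator fun s => 1 / Φ (1 / s)) := by
    intro a b hab
    by_cases ha : a ∈ Ioi (0 : ℝ)
    · have hb : b ∈ Ioi (0 : ℝ) := lt_of_lt_of_le ha hab
      rw [indicator_of_mem ha, indicator_of_mem hb]
      exact one_div_le_one_div_of_le (hΦpos _ (one_div_mem_Ioi_zero hb))
        (hΦmono (one_div_mem_Ioi_zero hb) (one_div_mem_Ioi_zero ha)
          (one_div_le_one_div_of_le ha hab))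
    · rw [indicator_of_notMem ha]
      exact indicator_nonneg
        (fun s hs => (one_div_pos.2 (hΦpos _ (one_div_mem_Ioi_zero hs))).le) b
  refine (hmono.intervalIntegrable (a := 0) (b := x)).congr fun s hs => ?_
  rw [uIoc_of_le hx.le] at hs
  exact indicator_of_mem (s := Ioi (0 : ℝ)) hs.1 _

/-- The fundamental theorem of calculus for `Gfun`. -/
theorem hasDerivAt_Gfun {Φ : ℝ → ℝ} (hΦc : ContinuousOn Φ (Ioi 0))
    (hΦpos : ∀ x ∈ Ioi (0 : ℝ), 0 < Φ x) (hΦmono : MonotoneOn Φ (Ioi 0)) {x : ℝ} (hx : 0 < x) :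
    HasDerivAt (Gfun Φ) (1 / Φ (1 / x)) x := by
  have hcont : ContinuousOn (fun s => 1 / Φ (1 / s)) (Ioi 0) :=
    continuousOn_const.div
      (hΦc.comp (continuousOn_const.div continuousOn_id fun s hs => ne_of_gt hs)
        fun s hs => one_div_mem_Ioi_zero hs)
      fun s hs => (hΦpos _ (one_div_mem_Ioi_zero hs)).ne'
  exact intervalIntegral.integral_hasDerivAt_right
    (intervalIntegrable_one_div_comp_one_div hΦpos hΦmono hx)
    (hcont.stronglyMeasurableAtFilter isOpen_Ioi x hx) (hcont.continuousAt (Ioi_mem_nhds hx))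

/-- ODE comparison: if `h > 0` and `h' ≤ Φ(h)·h²` on `[0,T)`, then
`G(1/h(t)) ≥ G(1/h(0)) − t` for all `t ∈ [0,T)`. -/
theorem ode_comparison_upper (T : ENNReal) (hT : 0 < T)
    (Φ : ℝ → ℝ) (hΦc : ContinuousOn Φ (Ioi 0)) (hΦpos : ∀ x ∈ Ioi (0 : ℝ), 0 < Φ x)
    (hΦmono : MonotoneOn Φ (Ioi 0)) (h h' : ℝ → ℝ)
    (hderiv : ∀ t : ℝ, 0 ≤ t → ENNReal.ofReal t < T → HasDerivAt h (h' t) t)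
    (hpos : ∀ t : ℝ, 0 ≤ t → ENNReal.ofReal t < T → 0 < h t)
    (hineq : ∀ t : ℝ, 0 ≤ t → ENNReal.ofReal t < T → h' t ≤ Φ (h t) * (h t) ^ 2) :
    ∀ t : ℝ, 0 ≤ t → ENNReal.ofReal t < T →
      Gfun Φ (1 / h 0) - t ≤ Gfun Φ (1 / h t) := by
  intro t ht htT
  have hlt : ∀ s ∈ Icc 0 t, ENNReal.ofReal s < T := fun s hs =>
    (ENNReal.ofReal_le_ofReal hs.2).trans_lt htT
  have hF : ∀ s ∈ Icc 0 t, HasDerivAt (fun r => Gfun Φ (1 / h r) + r)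
      (1 / Φ (h s) * (-h' s / h s ^ 2) + 1) s := by
    intro s hs
    have hp := hpos s hs.1 (hlt s hs)
    have hG := hasDerivAt_Gfun hΦc hΦpos hΦmono (one_div_pos.2 hp)
    have hinv : HasDerivAt (fun r => 1 / h r) (-h' s / h s ^ 2) s := by
      simpa only [one_div] using (hderiv s hs.1 (hlt s hs)).fun_inv hp.ne'
    have hcomp := (hG.comp s hinv).add (hasDerivAt_id s)
    rwa [one_div_one_div] at hcomp
  have hmono : MonotoneOn (fun r => Gfun Φ (1 / h r) + r) (Icc 0 t) := by
    refine monotoneOn_of_hasDerivWithinAt_nonneg (convex_Icc 0 t)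
      (fun s hs => (hF s hs).continuousAt.continuousWithinAt)
      (fun s hs => (hF s (interior_subset hs)).hasDerivWithinAt) fun s hs => ?_
    have hs := interior_subset hs
    have hp := hpos s hs.1 (hlt s hs)
    have hle : h' s / (Φ (h s) * h s ^ 2) ≤ 1 :=
      div_le_one_of_le₀ (hineq s hs.1 (hlt s hs)) (mul_pos (hΦpos _ hp) (pow_pos hp 2)).le
    have heq : 1 / Φ (h s) * (-h' s / h s ^ 2) = -(h' s / (Φ (h s) * h s ^ 2)) := by
      rw [div_mul_div_comm, one_mul, neg_div]
    linarith
  have h0t := hmono (left_mem_Icc.2 ht) (right_mem_Icc.2 ht) ht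
  dsimp only at h0t
  linarith
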